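/- Let P be an atomless probability measure on a measurable space (Ω, 𝓕) and let ρ : 𝒳 → ℝ satisfy: ρ(s) = s for every constant s ∈ ℝ; ρ(X) ≤ ρ(Y) whenever X ≤ Y pointwise; ρ(X+Y) = ρ(X) + ρ(Y) for all X, Y ∈ 𝒳; and ρ(X) = ρ(Y) whenever the pushforward distributions of X and Y under P coincide. Then ρ(X) = ∫ X dP for all X ∈ 𝒳. -/

import Mathlib

open MeasureTheory Set

noncomputable section

/-- The uniform distribution on `[0,1]`. -/
def unif01 : Measure ℝ := volume.restrict (Icc (0:ℝ) 1)

/-- A probability measure is atomless (in the sense of the paper) if some measurable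
real-valued map pushes it forward to the uniform distribution on `[0,1]`. -/
def IsAtomlessProb {Ω : Type*} [MeasurableSpace Ω] (P : Measure Ω) : Prop :=
  IsProbabilityMeasure P ∧ ∃ U : Ω → ℝ, Measurable U ∧ P.map U = unif01

/-- Membership in `𝒳`: bounded measurable real-valued functions. -/
def BddMeas {Ω : Type*} [MeasurableSpace Ω] (X : Ω → ℝ) : Prop :=
  Measurable X ∧ ∃ C : ℝ, ∀ ω, |X ω| ≤ C

/-- A monotone additive function on `[0,1]` is linear. -/
lemma eq_mul_of_monotone_of_additive {g : ℝ → ℝ}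
    (hmono : ∀ p q, 0 ≤ p → p ≤ q → q ≤ 1 → g p ≤ g q)
    (hadd : ∀ p q, 0 ≤ p → 0 ≤ q → p + q ≤ 1 → g (p + q) = g p + g q)
    {p : ℝ} (hp0 : 0 ≤ p) (hp1 : p ≤ 1) : g p = g 1 * p := by
  have h0 : g 0 = 0 := by
    have := hadd 0 0 le_rfl le_rfl (by norm_num)
    rw [add_zero] at this
    linarith
  have hc : 0 ≤ g 1 := h0 ▸ hmono 0 1 le_rfl zero_le_one le_rfl
  have hmul : ∀ (k : ℕ) (x : ℝ), 0 ≤ x → k * x ≤ 1 → g (k * x) = k * g x := by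
    intro k x hx
    induction k with
    | zero => simp [h0]
    | succ k ih =>
      intro h
      push_cast at h ⊢
      rw [add_mul, one_mul] at h ⊢
      rw [hadd _ _ (by positivity) hx h, ih (by linarith)]
      ring
  have hbound : ∀ n : ℕ, |g p - g 1 * p| ≤ g 1 * (1 / ((n : ℝ) + 1)) := by
    intro n
    have hn : (0 : ℝ) < (n : ℝ) + 1 := by positivity
    have hunit : g (1 / ((n : ℝ) + 1)) = g 1 * (1 / ((n : ℝ) + 1)) := by
      have h := hmul (n + 1) (1 / ((n : ℝ) + 1)) (by positivity)
        (by push_cast; exact (mul_one_div_cancel hn.ne').le)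
      push_cast at h
      rw [mul_one_div_cancel hn.ne'] at h
      rw [h]
      field_simp
    have hgrid : ∀ k : ℕ, k * (1 / ((n : ℝ) + 1)) ≤ 1 →
        g (k * (1 / ((n : ℝ) + 1))) = g 1 * (k * (1 / ((n : ℝ) + 1))) := by
      intro k hk
      rw [hmul k _ (by positivity) hk, hunit]
      ring
    set d : ℝ := 1 / ((n : ℝ) + 1) with hd
    have hdpos : 0 < d := by positivity
    set k := ⌊p / d⌋₊
    have hk1 : k * d ≤ p := (le_div_iff₀ hdpos).1 (Nat.floor_le (by positivity))
    have hk2 : p < (k + 1) * d := (div_lt_iff₀ hdpos).1 (Nat.lt_floor_add_one _)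
    have hlow := hmono (k * d) p (by positivity) hk1 hp1
    rw [hgrid k (hk1.trans hp1)] at hlow
    have hlow' : g 1 * p ≤ g 1 * ((k + 1) * d) := by gcongr
    have hup : g p ≤ g 1 * ((k + 1) * d) := by
      by_cases hle : (k + 1) * d ≤ 1
      · have h := hgrid (k + 1) (by push_cast; exact hle)
        push_cast at h
        exact h ▸ hmono p _ hp0 hk2.le hle
      · calc g p ≤ g 1 := hmono p 1 hp0 hp1 le_rfl
          _ = g 1 * 1 := (mul_one _).symm
          _ ≤ _ := by gcongr; exact (not_le.1 hle).le
    have hup' : g 1 * (k * d) ≤ g 1 * p := by gcongr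
    rw [abs_le]
    constructor <;> nlinarith
  have hlim : Filter.Tendsto (fun n : ℕ => g 1 * (1 / ((n : ℝ) + 1))) Filter.atTop (nhds 0) := by
    simpa using tendsto_one_div_add_atTop_nhds_zero_nat.const_mul (g 1)
  have := ge_of_tendsto' hlim hbound
  exact sub_eq_zero.1 (abs_nonpos_iff.1 this)

lemma map_indicator_const_congr {Ω : Type*} [MeasurableSpace Ω] (P : Measure Ω)
    [IsFiniteMeasure P] {A B : Set Ω} (hA : MeasurableSet A) (hB : MeasurableSet B)
    (hAB : P A = P B) (c : ℝ) :
    P.map (A.indicator fun _ => c) = P.map (B.indicator fun _ => c) := by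
  ext s hs
  rw [Measure.map_apply (measurable_const.indicator hA) hs,
    Measure.map_apply (measurable_const.indicator hB) hs]
  have hcompl : P Aᶜ = P Bᶜ := by
    rw [measure_compl hA (measure_ne_top _ _), measure_compl hB (measure_ne_top _ _), hAB]
  classical
  by_cases hc : c ∈ s <;> by_cases h0 : (0 : ℝ) ∈ s <;>
    simp [Set.indicator_const_preimage_eq_union, hc, h0, hAB, hcompl]

lemma bddMeas_indicator_const {Ω : Type*} [MeasurableSpace Ω] {A : Set Ω}
    (hA : MeasurableSet A) (c : ℝ) : BddMeas (A.indicator fun _ => c) := by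
  refine ⟨measurable_const.indicator hA, |c|, fun ω => ?_⟩
  by_cases h : ω ∈ A <;> simp [h]

lemma bddMeas_const {Ω : Type*} [MeasurableSpace Ω] (c : ℝ) : BddMeas (fun _ : Ω => c) :=
  ⟨measurable_const, |c|, fun _ => le_rfl⟩

lemma BddMeas.add {Ω : Type*} [MeasurableSpace Ω] {X Y : Ω → ℝ} (hX : BddMeas X)
    (hY : BddMeas Y) : BddMeas (fun ω => X ω + Y ω) := by
  obtain ⟨hX, C, hC⟩ := hX
  obtain ⟨hY, D, hD⟩ := hY
  exact ⟨hX.add hY, C + D, fun ω => (abs_add_le _ _).trans (add_le_add (hC ω) (hD ω))⟩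

lemma BddMeas.integrable {Ω : Type*} [MeasurableSpace Ω] {P : Measure Ω} [IsFiniteMeasure P]
    {X : Ω → ℝ} (hX : BddMeas X) : Integrable X P :=
  Integrable.of_bound hX.1.aestronglyMeasurable hX.2.choose
    (Filter.Eventually.of_forall hX.2.choose_spec)

lemma measure_preimage_Iic_of_map_eq_unif01 {Ω : Type*} [MeasurableSpace Ω] {P : Measure Ω}
    {U : Ω → ℝ} (hU : Measurable U) (hmap : P.map U = unif01) {p : ℝ} (hp1 : p ≤ 1) :
    P (U ⁻¹' Iic p) = ENNReal.ofReal p := by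
  rw [← Measure.map_apply hU measurableSet_Iic, hmap, unif01,
    Measure.restrict_apply measurableSet_Iic]
  have : Iic p ∩ Icc 0 1 = Icc 0 p := by
    ext x
    simp only [mem_inter_iff, mem_Iic, mem_Icc]
    constructor
    · rintro ⟨h1, h2, h3⟩
      exact ⟨h2, h1⟩
    · rintro ⟨h1, h2⟩
      exact ⟨h2, h1, h2.trans hp1⟩
  rw [this, Real.volume_Icc, sub_zero]

lemma measure_preimage_Ioc_of_map_eq_unif01 {Ω : Type*} [MeasurableSpace Ω] {P : Measure Ω}
    {U : Ω → ℝ} (hU : Measurable U) (hmap : P.map U = unif01) {p q : ℝ} (hp0 : 0 ≤ p)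
    (hq1 : q ≤ 1) : P (U ⁻¹' Ioc p q) = ENNReal.ofReal (q - p) := by
  rw [← Measure.map_apply hU measurableSet_Ioc, hmap, unif01,
    Measure.restrict_apply measurableSet_Ioc]
  have : Ioc p q ∩ Icc 0 1 = Ioc p q :=
    inter_eq_left.2 fun x hx => ⟨hp0.trans hx.1.le, hx.2.trans hq1⟩
  rw [this, Real.volume_Ioc]

/-- The number of thresholds `δ, 2δ, …, Nδ` lying below `x`, counted with weight `δ`,
approximates `x` from below up to `δ`. -/
lemma sum_threshold_le_and_le_add {δ x : ℝ} (hδ : 0 < δ) (hx : 0 ≤ x) {N : ℕ} (hN : x ≤ N * δ) :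
    (∑ k ∈ Finset.range N, if (k + 1) * δ ≤ x then δ else 0) ≤ x ∧
      x ≤ (∑ k ∈ Finset.range N, if (k + 1) * δ ≤ x then δ else 0) + δ := by
  have hfilter : (Finset.range N).filter (fun k : ℕ => ((k : ℝ) + 1) * δ ≤ x) =
      Finset.range ⌊x / δ⌋₊ := by
    ext k
    have key : ((k : ℝ) + 1) * δ ≤ x ↔ k < ⌊x / δ⌋₊ := by
      rw [← le_div_iff₀ hδ, ← Nat.succ_le_iff, Nat.le_floor_iff (by positivity)]
      push_cast
      rfl
    have hfl : ⌊x / δ⌋₊ ≤ N := by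
      have := Nat.floor_le_floor ((div_le_iff₀ hδ).2 hN)
      rwa [Nat.floor_natCast] at this
    simp only [Finset.mem_filter, Finset.mem_range, key]
    omega
  rw [← Finset.sum_filter, hfilter, Finset.sum_const, Finset.card_range, nsmul_eq_mul]
  refine ⟨(le_div_iff₀ hδ).1 (Nat.floor_le (by positivity)), ?_⟩
  have := (div_lt_iff₀ hδ).1 (Nat.lt_floor_add_one (x / δ))
  linarith

/-- A standard, monotone, additive, `P`-law-invariant functional on bounded measurable
functions is the expectation under `P`. -/
theorem additive_law_invariant_is_mean {Ω : Type*} [MeasurableSpace Ω]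
    (P : Measure Ω) (hP : IsAtomlessProb P)
    (ρ : (Ω → ℝ) → ℝ)
    (h_standard : ∀ s : ℝ, ρ (fun _ => s) = s)
    (h_mono : ∀ X Y : Ω → ℝ, BddMeas X → BddMeas Y → (∀ ω, X ω ≤ Y ω) → ρ X ≤ ρ Y)
    (h_add : ∀ X Y : Ω → ℝ, BddMeas X → BddMeas Y → ρ (fun ω => X ω + Y ω) = ρ X + ρ Y)
    (h_law : ∀ X Y : Ω → ℝ, BddMeas X → BddMeas Y → P.map X = P.map Y → ρ X = ρ Y) :
    ∀ X : Ω → ℝ, BddMeas X → ρ X = ∫ ω, X ω ∂P := by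
  obtain ⟨_, U, hU, hUmap⟩ := hP
  have h_ind : ∀ (c : ℝ), 0 ≤ c → ∀ A : Set Ω, MeasurableSet A →
      ρ (A.indicator fun _ => c) = ∫ ω, A.indicator (fun _ => c) ω ∂P := by
    intro c hc A hA
    have hmeas : ∀ p, MeasurableSet (U ⁻¹' Iic p) := fun p => hU measurableSet_Iic
    have hB := fun p => bddMeas_indicator_const (hmeas p) c
    have hlin := eq_mul_of_monotone_of_additive
      (g := fun p => ρ ((U ⁻¹' Iic p).indicator fun _ => c))
      (fun p q _ hpq _ => h_mono _ _ (hB p) (hB q) fun ω =>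
        indicator_le_indicator_of_subset (preimage_mono (Iic_subset_Iic.2 hpq))
          (fun _ => hc) ω)
      (fun p q hp hq hpq => by
        have hm : MeasurableSet (U ⁻¹' Ioc p (p + q)) := hU measurableSet_Ioc
        have hBI := bddMeas_indicator_const hm c
        have hlaw : ρ ((U ⁻¹' Iic q).indicator fun _ => c) =
            ρ ((U ⁻¹' Ioc p (p + q)).indicator fun _ => c) :=
          h_law _ _ (hB q) hBI (map_indicator_const_congr P (hmeas q) hm (by
            rw [measure_preimage_Iic_of_map_eq_unif01 hU hUmap (by linarith),
              measure_preimage_Ioc_of_map_eq_unif01 hU hUmap hp hpq, add_sub_cancel_left]) c)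
        simp only [hlaw]
        rw [← h_add _ _ (hB p) hBI]
        congr 1
        have hdisj : Disjoint (U ⁻¹' Iic p) (U ⁻¹' Ioc p (p + q)) :=
          Disjoint.preimage U (Iic_disjoint_Ioc le_rfl)
        rw [← indicator_union_of_disjoint hdisj, ← preimage_union,
          Iic_union_Ioc_eq_Iic (by linarith)])
      (p := P.real A) measureReal_nonneg measureReal_le_one
    have hA' : ρ (A.indicator fun _ => c) =
        ρ ((U ⁻¹' Iic (P.real A)).indicator fun _ => c) :=
      h_law _ _ (bddMeas_indicator_const hA c) (hB _)
        (map_indicator_const_congr P hA (hmeas _) (by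
          rw [measure_preimage_Iic_of_map_eq_unif01 hU hUmap measureReal_le_one,
            ofReal_measureReal]) c)
    have h1 : ρ ((U ⁻¹' Iic (1 : ℝ)).indicator fun _ => c) = c := by
      refine (h_law _ _ (hB 1) (bddMeas_const c) ?_).trans (h_standard c)
      have := map_indicator_const_congr P (hmeas 1) MeasurableSet.univ (by
        rw [measure_preimage_Iic_of_map_eq_unif01 hU hUmap le_rfl]; simp) c
      rwa [indicator_univ] at this
    rw [hA', hlin, h1, integral_indicator_const _ hA, smul_eq_mul, mul_comm]
  have h_sum : ∀ (δ : ℝ), 0 ≤ δ → ∀ A : ℕ → Set Ω, (∀ k, MeasurableSet (A k)) → ∀ N : ℕ,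
      BddMeas (fun ω => ∑ k ∈ Finset.range N, (A k).indicator (fun _ => δ) ω) ∧
      ρ (fun ω => ∑ k ∈ Finset.range N, (A k).indicator (fun _ => δ) ω) =
        ∫ ω, ∑ k ∈ Finset.range N, (A k).indicator (fun _ => δ) ω ∂P := by
    intro δ hδ A hA N
    induction N with
    | zero => simpa using ⟨bddMeas_const 0, h_standard 0⟩
    | succ N ih =>
      have hN := bddMeas_indicator_const (hA N) δ
      simp only [Finset.sum_range_succ]
      refine ⟨ih.1.add hN, ?_⟩
      rw [h_add _ _ ih.1 hN, ih.2, h_ind δ hδ _ (hA N),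
        integral_add ih.1.integrable hN.integrable]
  have h_nonneg : ∀ X : Ω → ℝ, BddMeas X → (∀ ω, 0 ≤ X ω) → ρ X = ∫ ω, X ω ∂P := by
    intro X hX hX0
    obtain ⟨C, hC⟩ := hX.2
    refine eq_of_forall_dist_le fun δ hδ => ?_
    obtain ⟨N, hN⟩ := exists_nat_ge (C / δ)
    have hbound : ∀ ω, X ω ≤ N * δ := fun ω =>
      (le_abs_self _).trans ((hC ω).trans ((div_le_iff₀ hδ).1 hN))
    obtain ⟨hY, hρY⟩ := h_sum δ hδ.le (fun k => {ω | ((k : ℝ) + 1) * δ ≤ X ω})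
      (fun k => measurableSet_le measurable_const hX.1) N
    set Y : Ω → ℝ := fun ω => ∑ k ∈ Finset.range N,
      ({ω | ((k : ℝ) + 1) * δ ≤ X ω} : Set Ω).indicator (fun _ => δ) ω with hYdef
    have hYX : ∀ ω, Y ω ≤ X ω ∧ X ω ≤ Y ω + δ := fun ω => by
      simpa only [hYdef, indicator_apply, mem_ofPred_eq] using
        sum_threshold_le_and_le_add hδ (hX0 ω) (hbound ω)
    have hYδ := hY.add (bddMeas_const δ)
    have h1 := h_mono Y X hY hX fun ω => (hYX ω).1
    have h2 := h_mono X _ hX hYδ fun ω => (hYX ω).2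
    rw [h_add _ _ hY (bddMeas_const δ), h_standard] at h2
    have h3 : ∫ ω, Y ω ∂P ≤ ∫ ω, X ω ∂P :=
      integral_mono hY.integrable hX.integrable fun ω => (hYX ω).1
    have h4 : ∫ ω, X ω ∂P ≤ ∫ ω, (Y ω + δ) ∂P :=
      integral_mono hX.integrable hYδ.integrable fun ω => (hYX ω).2
    rw [integral_add hY.integrable (integrable_const δ)] at h4
    simp only [integral_const, probReal_univ, one_smul] at h4
    rw [Real.dist_eq, abs_le]
    constructor <;> linarith
  intro X hX
  obtain ⟨C, hC⟩ := hX.2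
  have h := h_nonneg _ (hX.add (bddMeas_const C)) fun ω => by linarith [(abs_le.1 (hC ω)).1]
  rw [h_add _ _ hX (bddMeas_const C), h_standard,
    integral_add hX.integrable (integrable_const C)] at h
  simpa using h
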